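/- Let ψ_p, ω_p : X → (0, ∞) be bounded measurable twisting functions for p = 0, …, n. Then for each p ∈ {1, …, n}, the updated normalized distribution of the ω-twisted model can be written with respect to that of the ψ-twisted model as: for every measurable set S, η̂_{p-1}^ω(S) = [∫_S (M_p(ω_p)(x)/M_p(ψ_p)(x)) η̂_{p-1}^ψ(dx)] / η̂_{p-1}^ψ(M_p(ω_p)/M_p(ψ_p)). -/

import Mathlib

open MeasureTheory ProbabilityTheory ENNReal

noncomputable section

/-- A bounded, strictly positive, measurable `ℝ≥0∞`-valued function
(a potential or twisting function with values in `(0, ∞)`). -/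
def BddPos {X : Type*} [MeasurableSpace X] (f : X → ℝ≥0∞) : Prop :=
  Measurable f ∧ (∀ x, 0 < f x) ∧ ∃ C : ℝ≥0∞, C ≠ ⊤ ∧ ∀ x, f x ≤ C

/-- Predictive marginal measures `γ_p` of a Feynman–Kac model:
`γ_0 = M_0`, `γ_{p+1}(S) = ∫ γ_p(dx) G_p(x) M_{p+1}(x, S)`. -/
def fkGamma {X : Type*} [MeasurableSpace X] (M0 : Measure X)
    (M : ℕ → X → Measure X) (G : ℕ → X → ℝ≥0∞) : ℕ → Measure X
  | 0 => M0
  | p + 1 => ((fkGamma M0 M G p).withDensity (G p)).bind (M (p + 1))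

/-- Updated marginal measures `γ̂_p(S) = ∫_S G_p(x) γ_p(dx)`. -/
def fkGammaHat {X : Type*} [MeasurableSpace X] (M0 : Measure X)
    (M : ℕ → X → Measure X) (G : ℕ → X → ℝ≥0∞) (p : ℕ) : Measure X :=
  (fkGamma M0 M G p).withDensity (G p)

/-- The twist of a measure `μ` by a function `ψ` : `μ^ψ(dx) = μ(dx) ψ(x) / μ(ψ)`. -/
def fkTwist {X : Type*} [MeasurableSpace X] (μ : Measure X) (ψ : X → ℝ≥0∞) : Measure X :=
  (∫⁻ y, ψ y ∂μ)⁻¹ • μ.withDensity ψ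

/-- The `ψ`-twisted potential functions `G_p^ψ` for a model with terminal time `n`:
`G_0^ψ = (G_0/ψ_0) M_1(ψ_1) M_0(ψ_0)`, `G_p^ψ = (G_p/ψ_p) M_{p+1}(ψ_{p+1})` for
`1 ≤ p ≤ n-1`, and `G_n^ψ = G_n/ψ_n`. -/
def fkTwG {X : Type*} [MeasurableSpace X] (n : ℕ) (M0 : Measure X)
    (M : ℕ → X → Measure X) (G ψ : ℕ → X → ℝ≥0∞) (p : ℕ) (x : X) : ℝ≥0∞ :=
  G p x * (ψ p x)⁻¹ *
    (if p < n then ∫⁻ y, ψ (p + 1) y ∂(M (p + 1) x) else 1) *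
    (if p = 0 then ∫⁻ y, ψ 0 y ∂M0 else 1)

/-- Normalisation of a (finite, nonzero) measure. -/
def fkNorm {X : Type*} [MeasurableSpace X] (μ : Measure X) : Measure X :=
  (μ Set.univ)⁻¹ • μ

section Helpers

variable {X : Type*} [MeasurableSpace X]

theorem BddPos.lintegral_ne_top {f : X → ℝ≥0∞} (hf : BddPos f) (μ : Measure X)
    [IsFiniteMeasure μ] : ∫⁻ x, f x ∂μ ≠ ⊤ := by
  obtain ⟨-, -, C, hC, hfC⟩ := hf
  refine ne_top_of_le_ne_top (ENNReal.mul_ne_top hC (measure_ne_top μ Set.univ)) ?_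
  exact (lintegral_mono hfC).trans_eq (lintegral_const C)

theorem BddPos.lintegral_ne_zero {f : X → ℝ≥0∞} (hf : BddPos f) {μ : Measure X}
    (hμ : μ ≠ 0) : ∫⁻ x, f x ∂μ ≠ 0 := by
  intro h
  rw [lintegral_eq_zero_iff hf.1] at h
  refine hμ (Measure.measure_univ_eq_zero.1 ?_)
  have h' : μ {x | ¬ f x = 0} = 0 := h
  simpa [(hf.2.1 _).ne'] using h'

theorem BddPos.ne_top {f : X → ℝ≥0∞} (hf : BddPos f) (x : X) : f x ≠ ⊤ := by
  obtain ⟨-, -, C, hC, hfC⟩ := hf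
  exact ne_top_of_le_ne_top hC (hfC x)

theorem BddPos.ne_zero {f : X → ℝ≥0∞} (hf : BddPos f) (x : X) : f x ≠ 0 :=
  (hf.2.1 x).ne'

theorem BddPos.lintegral_kernel {f : X → ℝ≥0∞} (hf : BddPos f) (κ : Kernel X X)
    [IsMarkovKernel κ] : BddPos fun x => ∫⁻ y, f y ∂(κ x) := by
  refine ⟨hf.1.lintegral_kernel, fun x => ?_, ?_⟩
  · exact pos_iff_ne_zero.2 (hf.lintegral_ne_zero (IsProbabilityMeasure.ne_zero (κ x)))
  · obtain ⟨-, -, C, hC, hfC⟩ := hf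
    refine ⟨C, hC, fun x => (lintegral_mono hfC).trans_eq ?_⟩
    simp

theorem BddPos.isFiniteMeasure_withDensity {f : X → ℝ≥0∞} (hf : BddPos f) (μ : Measure X)
    [IsFiniteMeasure μ] : IsFiniteMeasure (μ.withDensity f) :=
  MeasureTheory.isFiniteMeasure_withDensity (hf.lintegral_ne_top μ)

theorem BddPos.withDensity_ne_zero {f : X → ℝ≥0∞} (hf : BddPos f) {μ : Measure X}
    (hμ : μ ≠ 0) : μ.withDensity f ≠ 0 := by
  rw [← Measure.measure_univ_ne_zero, withDensity_apply _ MeasurableSet.univ, setLIntegral_univ]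
  exact hf.lintegral_ne_zero hμ

/-- Multiplying a measure by a density and then binding with the twisted kernel cancels the
normalising constant of the twist. -/
theorem withDensity_bind_fkTwist (μ : Measure X) (κ : Kernel X X) [IsMarkovKernel κ]
    {f : X → ℝ≥0∞} (hf : BddPos f) :
    (μ.withDensity fun x => ∫⁻ y, f y ∂(κ x)).bind (fun x => fkTwist (κ x) f)
      = (μ.bind κ).withDensity f := by
  have hκf := hf.lintegral_kernel κ
  have happ : ∀ {S : Set X}, MeasurableSet S → ∀ x,
      fkTwist (κ x) f S = (∫⁻ y, f y ∂(κ x))⁻¹ * ∫⁻ y, S.indicator f y ∂(κ x) := by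
    intro S hS x
    rw [fkTwist, Measure.smul_apply, smul_eq_mul, withDensity_apply _ hS, lintegral_indicator hS]
  have hmeas : Measurable fun x => fkTwist (κ x) f := by
    refine Measure.measurable_of_measurable_coe _ fun S hS => ?_
    simp_rw [happ hS]
    exact hκf.1.inv.mul (hf.1.indicator hS).lintegral_kernel
  ext S hS
  have hmeasS : Measurable fun x => fkTwist (κ x) f S := (Measure.measurable_coe hS).comp hmeas
  rw [Measure.bind_apply hS hmeas.aemeasurable, withDensity_apply _ hS,
    lintegral_withDensity_eq_lintegral_mul _ hκf.1 hmeasS,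
    ← lintegral_indicator hS,
    Measure.lintegral_bind κ.measurable.aemeasurable (hf.1.indicator hS).aemeasurable]
  refine lintegral_congr fun x => ?_
  simp only [Pi.mul_apply, happ hS]
  rw [← mul_assoc, ENNReal.mul_inv_cancel (hκf.ne_zero x) (hκf.ne_top x), one_mul]

theorem fkGamma_isFiniteMeasure_and_ne_zero (n : ℕ) (M0 : Measure X) [IsProbabilityMeasure M0]
    (M : ℕ → Kernel X X) [∀ p, IsMarkovKernel (M p)] (G : ℕ → X → ℝ≥0∞)
    (hG : ∀ p ≤ n, BddPos (G p)) (p : ℕ) (hp : p ≤ n) :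
    IsFiniteMeasure (fkGamma M0 (fun q x => M q x) G p)
      ∧ fkGamma M0 (fun q x => M q x) G p ≠ 0 := by
  induction p with
  | zero => exact ⟨inferInstanceAs (IsFiniteMeasure M0), IsProbabilityMeasure.ne_zero M0⟩
  | succ p ih =>
    obtain ⟨hfin, hne⟩ := ih (Nat.le_of_succ_le hp)
    have hGp := hG p (Nat.le_of_succ_le hp)
    have hfin' := hGp.isFiniteMeasure_withDensity (fkGamma M0 (fun q x => M q x) G p)
    have hmass : fkGamma M0 (fun q x => M q x) G (p + 1) Set.univ
        = (fkGamma M0 (fun q x => M q x) G p).withDensity (G p) Set.univ := by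
      rw [fkGamma, Measure.bind_apply MeasurableSet.univ (M (p + 1)).measurable.aemeasurable]
      simp
    refine ⟨⟨hmass ▸ measure_lt_top _ _⟩, ?_⟩
    rw [← Measure.measure_univ_ne_zero, hmass, Measure.measure_univ_ne_zero]
    exact hGp.withDensity_ne_zero hne

/-- Before the terminal time, the updated measures of the twisted model have density
`M_{p+1}(ψ_{p+1})` with respect to those of the original model. -/
theorem fkGammaHat_twisted (n : ℕ) (M0 : Measure X) [IsProbabilityMeasure M0]
    (M : ℕ → Kernel X X) [∀ p, IsMarkovKernel (M p)] (G ψ : ℕ → X → ℝ≥0∞)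
    (hG : ∀ p ≤ n, BddPos (G p)) (hψ : ∀ p ≤ n, BddPos (ψ p)) (p : ℕ) (hp : p < n) :
    fkGammaHat (fkTwist M0 (ψ 0)) (fun q x => fkTwist (M q x) (ψ q))
        (fkTwG n M0 (fun q x => M q x) G ψ) p
      = (fkGammaHat M0 (fun q x => M q x) G p).withDensity
          fun x => ∫⁻ y, ψ (p + 1) y ∂(M (p + 1) x) := by
  have hGp := hG p hp.le
  have hψp := hψ p hp.le
  have hMψ := (hψ (p + 1) hp).lintegral_kernel (M (p + 1))
  have hψi : Measurable fun x => (ψ p x)⁻¹ := hψp.1.inv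
  induction p with
  | zero =>
    have h0 := hψp.lintegral_ne_zero (IsProbabilityMeasure.ne_zero M0)
    have htop := hψp.lintegral_ne_top M0
    simp only [fkGammaHat, fkGamma, fkTwist]
    have hT : Measurable (fkTwG n M0 (fun q x => M q x) G ψ 0) := by
      unfold fkTwG
      simp only [hp, if_true]
      exact ((hGp.1.mul hψi).mul hMψ.1).mul_const _
    rw [withDensity_smul_measure, ← withDensity_mul _ hψp.1 hT, ← withDensity_mul _ hGp.1 hMψ.1,
      ← withDensity_smul _ (hψp.1.mul hT)]
    congr 1
    ext x
    simp only [fkTwG, hp, if_true, Pi.mul_apply, Pi.smul_apply, smul_eq_mul]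
    calc _ = (ψ 0 x * (ψ 0 x)⁻¹) * ((∫⁻ y, ψ 0 y ∂M0) * (∫⁻ y, ψ 0 y ∂M0)⁻¹)
          * (G 0 x * ∫⁻ y, ψ (0 + 1) y ∂(M (0 + 1) x)) := by ring
      _ = _ := by
        rw [ENNReal.mul_inv_cancel (hψp.ne_zero x) (hψp.ne_top x),
          ENNReal.mul_inv_cancel h0 htop, one_mul, one_mul]
  | succ p ih =>
    have hp' : p < n := Nat.lt_of_succ_lt hp
    have ih := ih hp' (hG p hp'.le) (hψ p hp'.le) (hψp.lintegral_kernel (M (p + 1)))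
      (hψ p hp'.le).1.inv
    have hT : Measurable (fkTwG n M0 (fun q x => M q x) G ψ (p + 1)) := by
      unfold fkTwG
      simp only [hp, if_true, Nat.succ_ne_zero, if_false, mul_one]
      exact (hGp.1.mul hψi).mul hMψ.1
    simp only [fkGammaHat, fkGamma] at ih ⊢
    rw [ih, withDensity_bind_fkTwist _ (M (p + 1)) hψp, ← withDensity_mul _ hψp.1 hT,
      ← withDensity_mul _ hGp.1 hMψ.1]
    congr 1
    ext x
    simp only [fkTwG, hp, if_true, Nat.succ_ne_zero, if_false, mul_one, Pi.mul_apply]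
    calc _ = (ψ (p + 1) x * (ψ (p + 1) x)⁻¹)
          * (G (p + 1) x * ∫⁻ y, ψ (p + 1 + 1) y ∂(M (p + 1 + 1) x)) := by ring
      _ = _ := by rw [ENNReal.mul_inv_cancel (hψp.ne_zero x) (hψp.ne_top x), one_mul]

theorem fkNorm_withDensity_apply {μ : Measure X} [IsFiniteMeasure μ] (hμ : μ ≠ 0)
    (f : X → ℝ≥0∞) {S : Set X} (hS : MeasurableSet S) :
    fkNorm (μ.withDensity f) S
      = (∫⁻ x in S, f x ∂(fkNorm μ)) / ∫⁻ x, f x ∂(fkNorm μ) := by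
  have h0 : (μ Set.univ)⁻¹ ≠ 0 := ENNReal.inv_ne_zero.2 (measure_ne_top μ _)
  have htop : (μ Set.univ)⁻¹ ≠ ⊤ := ENNReal.inv_ne_top.2 (Measure.measure_univ_ne_zero.2 hμ)
  simp only [fkNorm, Measure.smul_apply, smul_eq_mul, withDensity_apply _ hS,
    withDensity_apply _ MeasurableSet.univ, setLIntegral_univ, Measure.restrict_smul,
    lintegral_smul_measure]
  rw [ENNReal.mul_div_mul_left _ _ h0 htop, mul_comm, ENNReal.div_eq_inv_mul, mul_comm]

end Helpers

theorem omega_twisted_updated_distribution {X : Type*} [MeasurableSpace X] (n : ℕ)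
    (M0 : Measure X) [IsProbabilityMeasure M0]
    (M : ℕ → Kernel X X) [∀ p, IsMarkovKernel (M p)]
    (G ψ ω : ℕ → X → ℝ≥0∞)
    (hG : ∀ p ≤ n, BddPos (G p)) (hψ : ∀ p ≤ n, BddPos (ψ p))
    (hω : ∀ p ≤ n, BddPos (ω p)) :
    ∀ p, 1 ≤ p → p ≤ n → ∀ S : Set X, MeasurableSet S →
      fkNorm (fkGammaHat (fkTwist M0 (ω 0)) (fun q x => fkTwist (M q x) (ω q))
          (fkTwG n M0 (fun q x => M q x) G ω) (p - 1)) S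
        = (∫⁻ x in S, (∫⁻ y, ω p y ∂(M p x)) / (∫⁻ y, ψ p y ∂(M p x))
              ∂(fkNorm (fkGammaHat (fkTwist M0 (ψ 0)) (fun q x => fkTwist (M q x) (ψ q))
                  (fkTwG n M0 (fun q x => M q x) G ψ) (p - 1))))
          / ∫⁻ x, (∫⁻ y, ω p y ∂(M p x)) / (∫⁻ y, ψ p y ∂(M p x))
              ∂(fkNorm (fkGammaHat (fkTwist M0 (ψ 0)) (fun q x => fkTwist (M q x) (ψ q))
                  (fkTwG n M0 (fun q x => M q x) G ψ) (p - 1))) := by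
  intro p hp1 hpn S hS
  obtain ⟨k, rfl⟩ : ∃ k, p = k + 1 := ⟨p - 1, by omega⟩
  simp only [Nat.add_sub_cancel]
  have hk : k < n := hpn
  obtain ⟨hfin, hne⟩ := fkGamma_isFiniteMeasure_and_ne_zero n M0 M G hG k hk.le
  have hMψ := (hψ (k + 1) hpn).lintegral_kernel (M (k + 1))
  have hMω := (hω (k + 1) hpn).lintegral_kernel (M (k + 1))
  rw [fkGammaHat_twisted n M0 M G ω hG hω k hk, fkGammaHat_twisted n M0 M G ψ hG hψ k hk]
  have hhat : IsFiniteMeasure (fkGammaHat M0 (fun q x => M q x) G k) :=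
    (hG k hk.le).isFiniteMeasure_withDensity _
  have hhat_ne : fkGammaHat M0 (fun q x => M q x) G k ≠ 0 :=
    (hG k hk.le).withDensity_ne_zero hne
  have := hMψ.isFiniteMeasure_withDensity (fkGammaHat M0 (fun q x => M q x) G k)
  have hdiv : Measurable fun x =>
      (∫⁻ y, ω (k + 1) y ∂(M (k + 1) x)) / ∫⁻ y, ψ (k + 1) y ∂(M (k + 1) x) :=
    hMω.1.div hMψ.1
  rw [← fkNorm_withDensity_apply (hMψ.withDensity_ne_zero hhat_ne) _ hS,
    ← withDensity_mul _ hMψ.1 hdiv]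
  congr 3
  ext x
  exact (ENNReal.mul_div_cancel (hMψ.ne_zero x) (hMψ.ne_top x)).symm

end
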